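/- Let n,m ≥ 1 and 1 ≤ i ≤ n. For all σ,σ' ∈ S_n and τ,τ' ∈ S_m one has B_i(σ,τ) ≤ B_i(σ',τ') in the left weak order on S_{n+m−1} if and only if σ ≤ σ' and τ ≤ τ'. In particular the map B_i : S_n × S_m → S_{n+m−1} is injective and order-preserving for the product of the weak orders. -/

import Mathlib

open Equiv

/-- The one-line value (0-indexed) of a permutation of `Fin N`, extended to all of `ℕ`
by the identity.  Position `j` (0-indexed) carries the value `pv σ j` (0-indexed). -/
def pv {N : ℕ} (σ : Equiv.Perm (Fin N)) (j : ℕ) : ℕ :=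
  if h : j < N then (σ ⟨j, h⟩ : ℕ) else j

/-- The left weak (Bruhat) order on `S_N`: inclusion of inversion sets, where the
inversion set of `σ` is `{(p,q) | p < q ∧ σ p > σ q}`. -/
def wle {N : ℕ} (σ τ : Equiv.Perm (Fin N)) : Prop :=
  ∀ p q : Fin N, p < q → σ q < σ p → τ q < τ p

instance {N : ℕ} (σ τ : Equiv.Perm (Fin N)) : Decidable (wle σ τ) :=
  inferInstanceAs (Decidable (∀ p q : Fin N, p < q → σ q < σ p → τ q < τ p))

/-- The `a`-values of the insertion construction `B_i` (0-indexed values):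
`avv m s x = x` if `x < s` and `x + m - 1` otherwise. -/
def avv (m s x : ℕ) : ℕ := if x < s then x else x + m - 1

/-- The one-line values of the permutation `B_i(σ,τ) ∈ S_{n+m-1}`
(0-indexed position `i`, with `i < n`, and 0-indexed values). -/
def BFun {n m : ℕ} (i : ℕ) (σ : Equiv.Perm (Fin n)) (τ : Equiv.Perm (Fin m)) (j : ℕ) : ℕ :=
  if j < i then avv m (pv σ i) (pv σ j)
  else if j < i + m then pv τ (j - i) + pv σ i
  else avv m (pv σ i) (pv σ (j - m + 1))

/-- `ρ ∈ S_{n+m-1}` is the permutation `B_i(σ,τ)`. -/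
def IsB {n m : ℕ} (i : ℕ) (σ : Equiv.Perm (Fin n)) (τ : Equiv.Perm (Fin m))
    (ρ : Equiv.Perm (Fin (n + m - 1))) : Prop :=
  ∀ j : ℕ, j < n + m - 1 → pv ρ j = BFun i σ τ j

theorem pv_of_lt {N : ℕ} (σ : Equiv.Perm (Fin N)) {j : ℕ} (h : j < N) :
    pv σ j = (σ ⟨j, h⟩ : ℕ) := by
  simp [pv, h]

theorem pv_lt {N : ℕ} (σ : Equiv.Perm (Fin N)) {j : ℕ} (h : j < N) : pv σ j < N := by
  rw [pv_of_lt σ h]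
  exact (σ _).isLt

theorem pv_ne {N : ℕ} (σ : Equiv.Perm (Fin N)) {j k : ℕ} (hj : j < N) (hk : k < N)
    (hjk : j ≠ k) : pv σ j ≠ pv σ k := by
  rw [pv_of_lt σ hj, pv_of_lt σ hk]
  intro h
  exact hjk (Fin.mk.inj_iff.mp (σ.injective (Fin.ext h)))

theorem wle_iff_pv {N : ℕ} (σ τ : Equiv.Perm (Fin N)) :
    wle σ τ ↔ ∀ p q : ℕ, p < q → q < N → pv σ q < pv σ p → pv τ q < pv τ p := by
  constructor
  · intro h p q hpq hq
    rw [pv_of_lt σ hq, pv_of_lt τ hq, pv_of_lt σ (hpq.trans hq), pv_of_lt τ (hpq.trans hq)]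
    exact h ⟨p, _⟩ ⟨q, _⟩ hpq
  · intro h p q hpq hlt
    have := h p q hpq q.isLt
    rw [pv_of_lt σ q.isLt, pv_of_lt τ q.isLt, pv_of_lt σ p.isLt, pv_of_lt τ p.isLt] at this
    exact this hlt

theorem wle_refl {N : ℕ} (σ : Equiv.Perm (Fin N)) : wle σ σ := fun _ _ _ h => h

theorem wle_antisymm {N : ℕ} {σ τ : Equiv.Perm (Fin N)} (h₁ : wle σ τ) (h₂ : wle τ σ) :
    σ = τ := by
  have key : ∀ p q : Fin N, σ p < σ q → τ p < τ q := by
    intro p q hpq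
    rcases lt_trichotomy p q with h | rfl | h
    · by_contra hle
      have hne : τ q ≠ τ p := τ.injective.ne h.ne'
      exact lt_asymm hpq (h₂ p q h (lt_of_le_of_ne (not_lt.mp hle) hne))
    · exact absurd hpq (lt_irrefl _)
    · exact h₁ q p h hpq
  have hmono : StrictMono (τ ∘ σ.symm) := fun a b hab => key _ _ (by simpa using hab)
  have hid : OrderIso.refl (Fin N) =
      hmono.orderIsoOfSurjective _ (τ.surjective.comp σ.symm.surjective) :=
    Subsingleton.elim _ _
  ext p
  have := congrArg (fun e : Fin N ≃o Fin N => ((e (σ p) : Fin N) : ℕ)) hid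
  simpa using this

/-- Positions of `B_i(σ,τ)` collapsed to positions of `σ`: the inserted block goes to `i`. -/
def blockCollapse (i m j : ℕ) : ℕ :=
  if j < i then j else if j < i + m then i else j - m + 1

theorem BFun_lt_iff_of_mem_block {n m : ℕ} {i : ℕ} (σ : Equiv.Perm (Fin n))
    (τ : Equiv.Perm (Fin m)) {p q : ℕ} (hpq : p < q) (hp : i ≤ p) (hq : q < i + m) :
    BFun i σ τ q < BFun i σ τ p ↔ pv τ (q - i) < pv τ (p - i) := by
  simp only [BFun]
  split_ifs <;> omega

theorem BFun_lt_iff_of_not_mem_block {n m : ℕ} (hm : 1 ≤ m) {i : ℕ} (hi : i < n)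
    (σ : Equiv.Perm (Fin n)) (τ : Equiv.Perm (Fin m)) {p q : ℕ} (hpq : p < q)
    (hq : q < n + m - 1) (hb : ¬ (i ≤ p ∧ q < i + m)) :
    BFun i σ τ q < BFun i σ τ p ↔
      pv σ (blockCollapse i m q) < pv σ (blockCollapse i m p) := by
  have hne : ∀ {j : ℕ}, j < n → j ≠ i → pv σ j ≠ pv σ i := fun hj h => pv_ne σ hj hi h
  have hτ : ∀ {k : ℕ}, k < m → pv τ k < m := fun hk => pv_lt τ hk
  simp only [BFun, blockCollapse]
  rcases lt_or_ge p i with hp | hp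
  · have hp' := hne (hp.trans hi) hp.ne
    rcases lt_or_ge q i with hqi | hqi
    · have hq' := hne (hqi.trans hi) hqi.ne
      simp only [hp, hqi, if_true, avv]
      split_ifs <;> omega
    · rcases lt_or_ge q (i + m) with hqm | hqm
      · have hq' := hτ (k := q - i) (by omega)
        simp only [hp, hqi.not_gt, hqm, if_true, if_false, avv]
        split_ifs <;> omega
      · have hq' := hne (j := q - m + 1) (by omega) (by omega)
        simp only [hp, hqi.not_gt, hqm.not_gt, if_true, if_false, avv]
        split_ifs <;> omega
  · have hqm : i + m ≤ q := by omega
    have hqi : i ≤ q := by omega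
    have hq' := hne (j := q - m + 1) (by omega) (by omega)
    rcases lt_or_ge p (i + m) with hpm | hpm
    · have hp' := hτ (k := p - i) (by omega)
      simp only [hp.not_gt, hpm, hqi.not_gt, hqm.not_gt, if_true, if_false, avv]
      split_ifs <;> omega
    · have hp' := hne (j := p - m + 1) (by omega) (by omega)
      simp only [hp.not_gt, hpm.not_gt, hqi.not_gt, hqm.not_gt, if_false, avv]
      split_ifs <;> omega

theorem wle_iff_of_isB {n m : ℕ} (hm : 1 ≤ m) {i : ℕ} (hi : i < n)
    {σ σ' : Equiv.Perm (Fin n)} {τ τ' : Equiv.Perm (Fin m)}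
    {ρ ρ' : Equiv.Perm (Fin (n + m - 1))} (hρ : IsB i σ τ ρ) (hρ' : IsB i σ' τ' ρ') :
    wle ρ ρ' ↔ wle σ σ' ∧ wle τ τ' := by
  simp only [wle_iff_pv]
  constructor
  · intro h
    refine ⟨fun p q hpq hq => ?_, fun p q hpq hq => ?_⟩
    · obtain ⟨e, he⟩ : ∃ e : ℕ → ℕ, ∀ j, e j = if j ≤ i then j else j + m - 1 := ⟨_, fun _ => rfl⟩
      have hcol : ∀ j, blockCollapse i m (e j) = j := by
        intro j
        rw [he, blockCollapse]
        split_ifs <;> omega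
      have hlt : e p < e q := by
        rw [he, he]
        split_ifs <;> omega
      have hlt' : e q < n + m - 1 := by
        rw [he]
        split_ifs <;> omega
      have hb : ¬ (i ≤ e p ∧ e q < i + m) := by
        rw [he, he]
        split_ifs <;> omega
      have := h (e p) (e q) hlt hlt'
      rwa [hρ _ hlt', hρ _ (hlt.trans hlt'), hρ' _ hlt', hρ' _ (hlt.trans hlt'),
        BFun_lt_iff_of_not_mem_block hm hi σ τ hlt hlt' hb,
        BFun_lt_iff_of_not_mem_block hm hi σ' τ' hlt hlt' hb, hcol, hcol] at this
    · have := h (i + p) (i + q) (by omega) (by omega)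
      rwa [hρ _ (by omega), hρ _ (by omega), hρ' _ (by omega), hρ' _ (by omega),
        BFun_lt_iff_of_mem_block σ τ (by omega) (by omega) (by omega),
        BFun_lt_iff_of_mem_block σ' τ' (by omega) (by omega) (by omega),
        Nat.add_sub_cancel_left, Nat.add_sub_cancel_left] at this
  · rintro ⟨hσ, hτ⟩ p q hpq hq
    rw [hρ _ hq, hρ _ (hpq.trans hq), hρ' _ hq, hρ' _ (hpq.trans hq)]
    by_cases hb : i ≤ p ∧ q < i + m
    · rw [BFun_lt_iff_of_mem_block σ τ hpq hb.1 hb.2, BFun_lt_iff_of_mem_block σ' τ' hpq hb.1 hb.2]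
      exact hτ _ _ (by omega) (by omega)
    · rw [BFun_lt_iff_of_not_mem_block hm hi σ τ hpq hq hb,
        BFun_lt_iff_of_not_mem_block hm hi σ' τ' hpq hq hb]
      refine hσ _ _ ?_ ?_ <;> simp only [blockCollapse] <;> split_ifs <;> omega

/-- **Theorem.** `B_i(σ,τ) ≤ B_i(σ',τ')` in the weak order on `S_{n+m-1}` iff
`σ ≤ σ'` and `τ ≤ τ'`; in particular `B_i` is injective and order-preserving for the
product of the weak orders. -/
theorem B_orderIso {n m : ℕ} (hn : 1 ≤ n) (hm : 1 ≤ m) (i : ℕ) (hi : i < n)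
    (σ σ' : Equiv.Perm (Fin n)) (τ τ' : Equiv.Perm (Fin m))
    (ρ ρ' : Equiv.Perm (Fin (n + m - 1)))
    (hρ : IsB i σ τ ρ) (hρ' : IsB i σ' τ' ρ') :
    (wle ρ ρ' ↔ wle σ σ' ∧ wle τ τ') ∧ (ρ = ρ' → σ = σ' ∧ τ = τ') := by
  refine ⟨wle_iff_of_isB hm hi hρ hρ', ?_⟩
  rintro rfl
  have h₁ := (wle_iff_of_isB hm hi hρ hρ').mp (wle_refl ρ)
  have h₂ := (wle_iff_of_isB hm hi hρ' hρ).mp (wle_refl ρ)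
  exact ⟨wle_antisymm h₁.1 h₂.1, wle_antisymm h₁.2 h₂.2⟩
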